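/- arXiv:math/0006221 — 3 statements merged into one kernel-verified Lean document; each statement's English description precedes it below -/
import Mathlib

section
/- Let N ≥ 3 and let k, l, r be arbitrary integers. For all integers m ≥ 0 and n ≥ 1 with m + n ≤ N, the identity d^{m,n}_N(k,l,r;q,z) = d^{m,n}_N(k,l,r−1;q,z) + (q^N z)^r · d^{m,n−1}_{N−1}(k,l,k−r;q,z) holds in ℚ(q,z); moreover, for every integer m with 0 ≤ m ≤ N one has d^{m,0}_N(k,l,r;q,z) = d^{m,0}_N(k,l,r−1;q,z). -/
/-!
STATEMENT 14: For N ≥ 3 and arbitrary integers k, l, r: for m ≥ 0, n ≥ 1 with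
m + n ≤ N, d^{m,n}_N(k,l,r) = d^{m,n}_N(k,l,r-1) + (q^N z)^r d^{m,n-1}_{N-1}(k,l,k-r);
and for 0 ≤ m ≤ N, d^{m,0}_N(k,l,r) = d^{m,0}_N(k,l,r-1). (Identities in ℚ(q,z).)
-/

open MvPolynomial

noncomputable section

/-- The field `ℚ(q,z)` of rational functions in two variables. -/
abbrev K := FractionRing (MvPolynomial (Fin 2) ℚ)

/-- The variable `q` as an element of `ℚ(q,z)`. -/
def qK : K := algebraMap (MvPolynomial (Fin 2) ℚ) K (X 0)

/-- The variable `z` as an element of `ℚ(q,z)`. -/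
def zK : K := algebraMap (MvPolynomial (Fin 2) ℚ) K (X 1)

def phiQ (N : ℕ) (a : Fin N → ℤ) : ℤ := ∑ t : Fin N, (t.1 + 1 : ℤ) * a t
def phiZ (N : ℕ) (a : Fin N → ℤ) : ℤ := ∑ t : Fin N, a t

/-- The vertex `M_{m,n}` (coordinates 1-indexed in the paper; `j : Fin N`
is the coordinate `j.1 + 1`). -/
def Mvec (N : ℕ) (k l r : ℤ) (m n : ℕ) (j : Fin N) : ℤ :=
  if j.1 + 1 ≤ m then (if (j.1 + 1) % 2 = 1 then l else k - l)
  else if N - n < j.1 + 1 then (if (N - j.1) % 2 = 1 then r else k - r)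
  else 0

/-- The contribution `d^{m,n}_N(k,l,r;q,z)` of the vertex `M_{m,n}`, in `ℚ(q,z)`. -/
def dmn (N : ℕ) (k l r : ℤ) (m n : ℕ) : K :=
  qK ^ phiQ N (Mvec N k l r m n) * zK ^ phiZ N (Mvec N k l r m n) /
    ((∏ i ∈ Finset.Icc 1 (m / 2), (1 - qK ^ (i : ℤ))) *
     (∏ i ∈ Finset.Icc (m / 2 + 1) m, (1 - qK ^ (-(i : ℤ)) * zK⁻¹)) *
     (∏ i ∈ Finset.Icc (m + 1) (N - n), (1 - qK ^ (i : ℤ) * zK)) *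
     (∏ i ∈ Finset.Icc 1 (n / 2), (1 - qK ^ (-(i : ℤ)))) *
     (∏ i ∈ Finset.Icc (n / 2 + 1) n, (1 - qK ^ ((i : ℤ) - N - 1) * zK⁻¹)))

/-- `d^e_N(k,l,r;q,z)`: sum of `d^{m,n}_N` over `m, n ≥ 0` with `m+n < N`, or
`m+n = N` and `m` even. -/
def dE (N : ℕ) (k l r : ℤ) : K :=
  ∑ p ∈ (Finset.range (N + 1) ×ˢ Finset.range (N + 1)).filter
      (fun p => p.1 + p.2 < N ∨ (p.1 + p.2 = N ∧ Even p.1)),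
    dmn N k l r p.1 p.2

/-- `d^o_N(k,l,r;q,z)`: sum of `d^{m,n}_N` over `m, n ≥ 0` with `m+n < N`, or
`m+n = N` and `m` odd. -/
def dO (N : ℕ) (k l r : ℤ) : K :=
  ∑ p ∈ (Finset.range (N + 1) ×ˢ Finset.range (N + 1)).filter
      (fun p => p.1 + p.2 < N ∨ (p.1 + p.2 = N ∧ Odd p.1)),
    dmn N k l r p.1 p.2


lemma qK_ne_zero : qK ≠ 0 := by
  simp [qK]

lemma zK_ne_zero : zK ≠ 0 := by
  simp [zK]

lemma qK_pow_ne_one {b : ℕ} (hb : b ≠ 0) : qK ^ b ≠ 1 := by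
  intro h
  have h' : (X 0 : MvPolynomial (Fin 2) ℚ) ^ b = 1 := by
    apply IsFractionRing.injective (MvPolynomial (Fin 2) ℚ) K
    simpa [qK] using h
  have h2 := congrArg (MvPolynomial.eval fun _ => (2 : ℚ)) h'
  simp only [map_pow, eval_X, map_one] at h2
  exact (one_lt_pow₀ (by norm_num : (1 : ℚ) < 2) hb).ne' h2

lemma qK_pow_mul_zK_ne_one (b : ℕ) : qK ^ b * zK ≠ 1 := by
  intro h
  have h' : (X 0 : MvPolynomial (Fin 2) ℚ) ^ b * X 1 = 1 := by
    apply IsFractionRing.injective (MvPolynomial (Fin 2) ℚ) K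
    simpa [qK, zK] using h
  have h2 := congrArg (MvPolynomial.eval ![(1 : ℚ), 2]) h'
  simp at h2

lemma one_sub_qK_zpow_neg_ne_zero {b : ℕ} (hb : b ≠ 0) : 1 - qK ^ (-(b : ℤ)) ≠ 0 := by
  rw [sub_ne_zero, zpow_neg, zpow_natCast, ne_comm, Ne, inv_eq_one]
  exact qK_pow_ne_one hb

lemma one_sub_qK_zpow_neg_mul_inv_zK_ne_zero (b : ℕ) : 1 - qK ^ (-(b : ℤ)) * zK⁻¹ ≠ 0 := by
  rw [sub_ne_zero, zpow_neg, zpow_natCast, ← mul_inv, ne_comm, Ne, inv_eq_one]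
  exact qK_pow_mul_zK_ne_one b

lemma Mvec_castSucc (N : ℕ) (k l r : ℤ) (m n : ℕ) (h : m + n ≤ N) (t : Fin N) :
    Mvec (N + 1) k l r m (n + 1) t.castSucc = Mvec N k l (k - r) m n t := by
  have ht := t.2
  simp only [Mvec, Fin.val_castSucc]
  split_ifs <;> first | rfl | omega

lemma Mvec_last (N : ℕ) (k l r : ℤ) (m n : ℕ) (h : m + n ≤ N) :
    Mvec (N + 1) k l r m (n + 1) (Fin.last N) = r := by
  simp only [Mvec, Fin.val_last]
  split_ifs <;> first | rfl | omega

lemma Mvec_zero_right (N : ℕ) (k l r r' : ℤ) (m : ℕ) : Mvec N k l r m 0 = Mvec N k l r' m 0 := by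
  funext t
  have ht := t.2
  simp only [Mvec]
  split_ifs <;> first | rfl | omega

lemma phiQ_Mvec_succ (N : ℕ) (k l r : ℤ) (m n : ℕ) (h : m + n ≤ N) :
    phiQ (N + 1) (Mvec (N + 1) k l r m (n + 1)) =
      phiQ N (Mvec N k l (k - r) m n) + (N + 1) * r := by
  simp [phiQ, Fin.sum_univ_castSucc, Mvec_castSucc, Mvec_last, h]

lemma phiZ_Mvec_succ (N : ℕ) (k l r : ℤ) (m n : ℕ) (h : m + n ≤ N) :
    phiZ (N + 1) (Mvec (N + 1) k l r m (n + 1)) = phiZ N (Mvec N k l (k - r) m n) + r := by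
  simp [phiZ, Fin.sum_univ_castSucc, Mvec_castSucc, Mvec_last, h]

lemma phiQ_Mvec_sub_one (N : ℕ) (k l r : ℤ) (m n : ℕ) (h : m + n ≤ N) :
    phiQ N (Mvec N k l (r - 1) m n) =
      phiQ N (Mvec N k l r m n) - if n % 2 = 0 then ((n / 2 : ℕ) : ℤ) else N - (n / 2 : ℕ) := by
  induction n generalizing N r with
  | zero => simp [Mvec_zero_right N k l (r - 1) r]
  | succ n ih =>
    obtain ⟨N, rfl⟩ : ∃ M, N = M + 1 := ⟨N - 1, by omega⟩
    have := ih N (k - r + 1) (by omega)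
    rw [phiQ_Mvec_succ N k l _ m n (by omega), phiQ_Mvec_succ N k l _ m n (by omega),
      show k - (r - 1) = k - r + 1 by ring]
    rw [show k - r + 1 - 1 = k - r by ring] at this
    rw [this, mul_sub]
    push_cast
    split_ifs at * <;> omega

lemma phiZ_Mvec_sub_one (N : ℕ) (k l r : ℤ) (m n : ℕ) (h : m + n ≤ N) :
    phiZ N (Mvec N k l (r - 1) m n) =
      phiZ N (Mvec N k l r m n) - if n % 2 = 0 then 0 else 1 := by
  induction n generalizing N r with
  | zero => simp [Mvec_zero_right N k l (r - 1) r]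
  | succ n ih =>
    obtain ⟨N, rfl⟩ : ∃ M, N = M + 1 := ⟨N - 1, by omega⟩
    have := ih N (k - r + 1) (by omega)
    rw [phiZ_Mvec_succ N k l _ m n (by omega), phiZ_Mvec_succ N k l _ m n (by omega),
      show k - (r - 1) = k - r + 1 by ring]
    rw [show k - r + 1 - 1 = k - r by ring] at this
    split_ifs at * <;> omega

lemma dmn_zero_right (N : ℕ) (k l r r' : ℤ) (m : ℕ) : dmn N k l r m 0 = dmn N k l r' m 0 := by
  simp only [dmn, Mvec_zero_right N k l r r' m]

/-- Replacing `r` by `r - 1` scales `dmn` by a monomial `u` such that `1 - u` is the denominator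
factor that disappears when passing from `n` to `n - 1`. -/
lemma dmn_sub_one (N : ℕ) (k l r : ℤ) (m n : ℕ) (h : m + n ≤ N) :
    dmn N k l (r - 1) m n = dmn N k l r m n *
      if n % 2 = 0 then qK ^ (-((n / 2 : ℕ) : ℤ)) else qK ^ (-((N - n / 2 : ℕ) : ℤ)) * zK⁻¹ := by
  have hc : ((N - n / 2 : ℕ) : ℤ) = N - (n / 2 : ℕ) := by
    rw [Nat.cast_sub (by omega)]
  rw [dmn, dmn, phiQ_Mvec_sub_one N k l r m n h, phiZ_Mvec_sub_one N k l r m n h, div_mul_eq_mul_div,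
    hc]
  congr 1
  split_ifs
  · rw [sub_eq_add_neg, zpow_add₀ qK_ne_zero, sub_zero]
    ring
  · rw [sub_eq_add_neg, zpow_add₀ qK_ne_zero, sub_eq_add_neg (phiZ N _), zpow_add₀ zK_ne_zero,
      zpow_neg_one]
    ring

lemma prod_Icc_succ_shift (N a n : ℕ) :
    ∏ i ∈ Finset.Icc (a + 1) (n + 1), (1 - qK ^ ((i : ℤ) - (N + 1 : ℕ) - 1) * zK⁻¹) =
      ∏ i ∈ Finset.Icc a n, (1 - qK ^ ((i : ℤ) - N - 1) * zK⁻¹) := by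
  rw [← Finset.map_add_right_Icc, Finset.prod_map]
  refine Finset.prod_congr rfl fun i _ => ?_
  simp only [addRightEmbedding_apply]
  congr 3
  push_cast
  ring

/-- Multiplying by the extra denominator factor amounts to removing the last coordinate of the
vertex. -/
lemma dmn_mul_factor (N : ℕ) (k l r : ℤ) (m n : ℕ) (h : m + n ≤ N) :
    dmn (N + 1) k l r m (n + 1) *
      (1 - if (n + 1) % 2 = 0 then qK ^ (-(((n + 1) / 2 : ℕ) : ℤ))
        else qK ^ (-((N + 1 - (n + 1) / 2 : ℕ) : ℤ)) * zK⁻¹) =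
      (qK ^ (N + 1) * zK) ^ r * dmn N k l (k - r) m n := by
  have hmon : (qK ^ (N + 1) * zK) ^ r = qK ^ (((N : ℤ) + 1) * r) * zK ^ r := by
    rw [mul_zpow, ← zpow_natCast, ← zpow_mul]
    push_cast
    rfl
  rw [dmn, dmn, phiQ_Mvec_succ N k l r m n h, phiZ_Mvec_succ N k l r m n h, hmon,
    zpow_add₀ qK_ne_zero, zpow_add₀ zK_ne_zero, Nat.add_sub_add_right]
  rcases Nat.even_or_odd' n with ⟨b, rfl | rfl⟩
  · have h1 : (2 * b + 1) / 2 = b := by omega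
    have h2 : 2 * b / 2 = b := by omega
    have h3 : (2 * b + 1) % 2 ≠ 0 := by omega
    rw [if_neg h3, h1, h2, ← Finset.mul_prod_Ioc_eq_prod_Icc (by omega : b + 1 ≤ 2 * b + 1),
      ← Finset.Icc_add_one_left_eq_Ioc, prod_Icc_succ_shift,
      show ((b + 1 : ℕ) : ℤ) - (N + 1 : ℕ) - 1 = -((N + 1 - b : ℕ) : ℤ) by omega]
    have := one_sub_qK_zpow_neg_mul_inv_zK_ne_zero (N + 1 - b)
    generalize 1 - qK ^ (-((N + 1 - b : ℕ) : ℤ)) * zK⁻¹ = f at *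
    rw [div_mul_eq_mul_div, ← mul_div_assoc]
    refine Eq.trans ?_ (mul_div_mul_right _ _ this)
    congr 1 <;> ring1
  · have h1 : (2 * b + 1 + 1) / 2 = b + 1 := by omega
    have h2 : (2 * b + 1) / 2 = b := by omega
    have h3 : (2 * b + 1 + 1) % 2 = 0 := by omega
    rw [if_pos h3, h1, h2, Finset.prod_Icc_succ_top (by omega : 1 ≤ b + 1), prod_Icc_succ_shift]
    have := one_sub_qK_zpow_neg_ne_zero b.succ_ne_zero
    generalize 1 - qK ^ (-((b + 1 : ℕ) : ℤ)) = f at *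
    rw [div_mul_eq_mul_div, ← mul_div_assoc]
    refine Eq.trans ?_ (mul_div_mul_right _ _ this)
    congr 1 <;> ring1

theorem dmn_recursion (N : ℕ) (hN : 3 ≤ N) (k l r : ℤ) :
    (∀ m n : ℕ, 1 ≤ n → m + n ≤ N →
      dmn N k l r m n =
        dmn N k l (r - 1) m n + (qK ^ N * zK) ^ r * dmn (N - 1) k l (k - r) m (n - 1)) ∧
    (∀ m : ℕ, m ≤ N → dmn N k l r m 0 = dmn N k l (r - 1) m 0) := by
  refine ⟨fun m n hn hmn => ?_, fun m _ => dmn_zero_right N k l r (r - 1) m⟩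
  obtain ⟨N, rfl⟩ : ∃ M, N = M + 1 := ⟨N - 1, by omega⟩
  obtain ⟨n, rfl⟩ : ∃ p, n = p + 1 := ⟨n - 1, by omega⟩
  rw [dmn_sub_one _ k l r m _ hmn, Nat.add_sub_cancel, Nat.add_sub_cancel,
    ← dmn_mul_factor N k l r m n (by omega)]
  ring

end
end

section
/- Let N ≥ 2 and let k, l be arbitrary integers. For all integers m, n ≥ 0 with m + 2n + 1 ≤ N, one has d^{m,2n}_N(k,l,−1;q,z) = −d^{m,2n+1}_N(k,l,−1;q,z) in ℚ(q,z). -/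
/-!
STATEMENT 15: For N ≥ 2 and arbitrary integers k, l: for m, n ≥ 0 with
m + 2n + 1 ≤ N, d^{m,2n}_N(k,l,-1;q,z) = -d^{m,2n+1}_N(k,l,-1;q,z) in ℚ(q,z).
-/

open MvPolynomial

noncomputable section

lemma Mvec_two_mul_add_one {N : ℕ} (k l r : ℤ) {m n : ℕ} (h : m + 2 * n + 1 ≤ N) :
    Mvec N k l r m (2 * n + 1) =
      Mvec N k l r m (2 * n) + Pi.single (⟨N - 2 * n - 1, by omega⟩ : Fin N) r := by
  funext j
  by_cases hjt : j = ⟨N - 2 * n - 1, by omega⟩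
  · subst hjt
    have h₁ : ¬ N - 2 * n - 1 + 1 ≤ m := by omega
    have h₂ : N - (2 * n + 1) < N - 2 * n - 1 + 1 := by omega
    have h₃ : ¬ N - 2 * n < N - 2 * n - 1 + 1 := by omega
    have h₄ : (N - (N - 2 * n - 1)) % 2 = 1 := by omega
    simp only [Mvec, Pi.add_apply, Pi.single_eq_same, if_neg h₁, if_pos h₂, if_neg h₃,
      if_pos h₄, zero_add]
  · have hj := j.2
    have hne : j.1 ≠ N - 2 * n - 1 := fun e => hjt (Fin.ext e)
    have hiff : N - (2 * n + 1) < j.1 + 1 ↔ N - 2 * n < j.1 + 1 := by omega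
    simp only [Mvec, Pi.add_apply, Pi.single_eq_of_ne hjt, hiff, add_zero]

lemma phiQ_add_single {N : ℕ} (a : Fin N → ℤ) (t : Fin N) (r : ℤ) :
    phiQ N (a + Pi.single t r) = phiQ N a + (t.1 + 1) * r := by
  simp [phiQ, mul_add, Finset.sum_add_distrib, Pi.single_apply]

lemma phiZ_add_single {N : ℕ} (a : Fin N → ℤ) (t : Fin N) (r : ℤ) :
    phiZ N (a + Pi.single t r) = phiZ N a + r := by
  simp [phiZ, Finset.sum_add_distrib]

theorem dmn_alternating_at_r_neg_one (N : ℕ) (hN : 2 ≤ N) (k l : ℤ)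
    (m n : ℕ) (h : m + 2 * n + 1 ≤ N) :
    dmn N k l (-1) m (2 * n) = -dmn N k l (-1) m (2 * n + 1) := by
  have hq := qK_ne_zero
  have hz := zK_ne_zero
  set x : K := qK ^ ((N : ℤ) - 2 * n) * zK with hx
  have hx0 : x ≠ 0 := mul_ne_zero (zpow_ne_zero _ hq) hz
  have hQ : phiQ N (Mvec N k l (-1) m (2 * n + 1)) =
      phiQ N (Mvec N k l (-1) m (2 * n)) + -((N : ℤ) - 2 * n) := by
    rw [Mvec_two_mul_add_one k l (-1) h, phiQ_add_single]
    push_cast [show 1 ≤ N - 2 * n by omega, show 2 * n ≤ N by omega]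
    ring
  have hZ : phiZ N (Mvec N k l (-1) m (2 * n + 1)) =
      phiZ N (Mvec N k l (-1) m (2 * n)) + -1 := by
    rw [Mvec_two_mul_add_one k l (-1) h, phiZ_add_single]
  have hnum : qK ^ phiQ N (Mvec N k l (-1) m (2 * n + 1)) *
        zK ^ phiZ N (Mvec N k l (-1) m (2 * n + 1)) =
      qK ^ phiQ N (Mvec N k l (-1) m (2 * n)) *
        zK ^ phiZ N (Mvec N k l (-1) m (2 * n)) * x⁻¹ := by
    rw [hQ, hZ, zpow_add₀ hq, zpow_add₀ hz, hx, mul_inv, zpow_neg, zpow_neg_one]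
    ring
  have hmid : ∏ i ∈ Finset.Icc (m + 1) (N - 2 * n), (1 - qK ^ (i : ℤ) * zK) =
      (∏ i ∈ Finset.Icc (m + 1) (N - (2 * n + 1)), (1 - qK ^ (i : ℤ) * zK)) * (1 - x) := by
    rw [show N - 2 * n = N - (2 * n + 1) + 1 by omega,
      Finset.prod_Icc_succ_top (by omega), hx]
    congr 5
    omega
  have hlast : ∏ i ∈ Finset.Icc (n + 1) (2 * n + 1), (1 - qK ^ ((i : ℤ) - N - 1) * zK⁻¹) =
      (∏ i ∈ Finset.Icc (n + 1) (2 * n), (1 - qK ^ ((i : ℤ) - N - 1) * zK⁻¹)) *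
        -(x⁻¹ * (1 - x)) := by
    rw [Finset.prod_Icc_succ_top (by omega), mul_sub x⁻¹, inv_mul_cancel₀ hx0, mul_one, neg_sub,
      hx, mul_inv, ← zpow_neg]
    congr 4
    push_cast
    ring
  rw [dmn, dmn, hnum, hmid, show (2 * n + 1) / 2 = n by omega, show 2 * n / 2 = n by omega,
    hlast]
  generalize ∏ i ∈ Finset.Icc (m + 1) (N - (2 * n + 1)), (1 - qK ^ (i : ℤ) * zK) = C
  generalize ∏ i ∈ Finset.Icc (n + 1) (2 * n), (1 - qK ^ ((i : ℤ) - N - 1) * zK⁻¹) = E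
  generalize ∏ i ∈ Finset.Icc 1 n, (1 - qK ^ (-(i : ℤ))) = D
  generalize (∏ i ∈ Finset.Icc 1 (m / 2), (1 - qK ^ (i : ℤ))) *
    (∏ i ∈ Finset.Icc (m / 2 + 1) m, (1 - qK ^ (-(i : ℤ)) * zK⁻¹)) = A
  generalize qK ^ phiQ N (Mvec N k l (-1) m (2 * n)) *
    zK ^ phiZ N (Mvec N k l (-1) m (2 * n)) = B
  rw [show A * C * D * (E * -(x⁻¹ * (1 - x))) = -(A * (C * (1 - x)) * D * E) * x⁻¹ by ring,
    mul_div_mul_right _ _ (inv_ne_zero hx0), div_neg, neg_neg]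

end
end

section
/- Let N ≥ 1 and let k, a be arbitrary integers; consider the rational functions d^{m,2N−m}_{2N}(k, a, k−a; q,z) in ℚ(q,z) for 0 ≤ m ≤ 2N. Set P = q^{φ_q(M_{0,2N})} z^{φ_z(M_{0,2N})}, where M_{0,2N} ∈ ℤ^{2N} is the vertex vector for parameters (k, a, k−a) in ambient dimension 2N, and define in ℚ(q,z): Φ(s) = ∏_{i=1}^s (1−q^i)^{−1}, Ψ(a,b) = ∏_{i=a}^b (1−q^{−i}z^{−1})^{−1}, Φ^∨(s) = ∏_{i=1}^s (1−q^{−i})^{−1}. Then for every integer s with 0 ≤ s < N: (a) ∑_{m=0}^{2s} (−1)^m d^{m,2N−m}_{2N}(k,a,k−a;q,z) = P · (1−q^{−N})^{−1} · Φ(s) · Ψ(s+1, N+s) · Φ^∨(N−s−1); and (b) ∑_{m=0}^{2s+1} (−1)^m d^{m,2N−m}_{2N}(k,a,k−a;q,z) = −P · (1−q^{N})^{−1} · Φ(s) · Ψ(s+2, N+s+1) · Φ^∨(N−s−1). -/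
/-!
STATEMENT 16: partial alternating sums of the contributions d^{m,2N-m}_{2N}(k,a,k-a)
(identities in ℚ(q,z)), with Φ, Ψ, Φ^∨ as in the paper.
-/

open MvPolynomial

noncomputable section

/-- `Φ(s) = ∏_{i=1}^s (1-q^i)⁻¹`. -/
def PhiK (s : ℕ) : K := ∏ i ∈ Finset.Icc 1 s, (1 - qK ^ (i : ℤ))⁻¹

/-- `Ψ(a,b) = ∏_{i=a}^b (1-q^{-i}z^{-1})⁻¹`. -/
def PsiK (a b : ℕ) : K := ∏ i ∈ Finset.Icc a b, (1 - qK ^ (-(i : ℤ)) * zK⁻¹)⁻¹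

/-- `Φ^∨(s) = ∏_{i=1}^s (1-q^{-i})⁻¹`. -/
def PhiVK (s : ℕ) : K := ∏ i ∈ Finset.Icc 1 s, (1 - qK ^ (-(i : ℤ)))⁻¹

lemma qK_pow_mul_zK_pow_ne_one {i j : ℕ} (h : i + j ≠ 0) : qK ^ i * zK ^ j ≠ 1 := by
  intro H
  have H' : (X 0 ^ i * X 1 ^ j : MvPolynomial (Fin 2) ℚ) = 1 := by
    apply IsFractionRing.injective (MvPolynomial (Fin 2) ℚ) K
    simpa [qK, zK] using H
  have := congrArg (MvPolynomial.eval (fun _ => (0 : ℚ))) H'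
  rw [map_mul, map_pow, map_pow, eval_X, eval_X, ← pow_add, zero_pow h, map_one] at this
  exact zero_ne_one this

lemma qK_pow_ne_one_s16 {i : ℕ} (h : i ≠ 0) : qK ^ i ≠ 1 := by
  simpa using qK_pow_mul_zK_pow_ne_one (i := i) (j := 0) (by simpa using h)

lemma one_sub_qK_neg_mul_zK_inv_ne_zero (i : ℕ) : 1 - qK ^ (-(i : ℤ)) * zK⁻¹ ≠ 0 := by
  rw [sub_ne_zero, zpow_neg, zpow_natCast, ← mul_inv, ne_comm, Ne, inv_eq_one]
  simpa using qK_pow_mul_zK_pow_ne_one (i := i) (j := 1) (by simp)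

lemma PhiK_succ (s : ℕ) : PhiK (s + 1) = PhiK s * (1 - qK ^ (s + 1))⁻¹ := by
  rw [PhiK, Finset.prod_Icc_succ_top (by simp), PhiK, zpow_natCast]

lemma PhiVK_succ (s : ℕ) : PhiVK (s + 1) = PhiVK s * (1 - (qK ^ (s + 1))⁻¹)⁻¹ := by
  rw [PhiVK, Finset.prod_Icc_succ_top (by simp), PhiVK, zpow_neg, zpow_natCast]

lemma PsiK_succ_right {a b : ℕ} (h : a ≤ b + 1) :
    PsiK a (b + 1) = PsiK a b * (1 - qK ^ (-((b + 1 : ℕ) : ℤ)) * zK⁻¹)⁻¹ := by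
  rw [PsiK, Finset.prod_Icc_succ_top h, PsiK]

lemma PsiK_succ_left {a b : ℕ} (h : a ≤ b) :
    PsiK a b = (1 - qK ^ (-(a : ℤ)) * zK⁻¹)⁻¹ * PsiK (a + 1) b := by
  rw [PsiK, PsiK, ← Finset.insert_Icc_add_one_left_eq_Icc h, Finset.prod_insert (by simp)]

/-- On the diagonal `m + n = 2N` with `r = k - l` all vertices coincide. -/
lemma Mvec_diagonal (N : ℕ) (k a : ℤ) {m : ℕ} (hm : m ≤ 2 * N) :
    Mvec (2 * N) k a (k - a) m (2 * N - m) = Mvec (2 * N) k a (k - a) 0 (2 * N) := by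
  funext ⟨t, ht⟩
  simp only [Mvec]
  split_ifs <;> omega

lemma prod_Icc_reflect (N : ℕ) {m c : ℕ} (h : m + c ≤ 2 * N) :
    ∏ i ∈ Finset.Icc (c + 1) (2 * N - m), (1 - qK ^ ((i : ℤ) - (2 * N : ℕ) - 1) * zK⁻¹) =
      ∏ i ∈ Finset.Icc (m + 1) (2 * N - c), (1 - qK ^ (-(i : ℤ)) * zK⁻¹) := by
  refine Finset.prod_bij' (fun i _ => 2 * N + 1 - i) (fun i _ => 2 * N + 1 - i) ?_ ?_ ?_ ?_ ?_
  · intro i hi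
    rw [Finset.mem_Icc] at hi ⊢
    omega
  · intro i hi
    rw [Finset.mem_Icc] at hi ⊢
    omega
  · intro i hi
    rw [Finset.mem_Icc] at hi
    omega
  · intro i hi
    rw [Finset.mem_Icc] at hi
    omega
  · intro i hi
    rw [Finset.mem_Icc] at hi
    congr 3
    omega

lemma PsiK_mul_PsiK {a b c : ℕ} (h₁ : a ≤ b + 1) (h₂ : b ≤ c) :
    PsiK a b * PsiK (b + 1) c = PsiK a c := by
  have h : ∀ x y, Finset.Icc x y = Finset.Ico x (y + 1) := fun x y => by
    ext; simp
  rw [PsiK, PsiK, PsiK, h, h, h]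
  exact Finset.prod_Ico_consecutive _ h₁ (by omega)

lemma dmn_diagonal (N : ℕ) (k a : ℤ) {m : ℕ} (hm : m ≤ 2 * N) :
    dmn (2 * N) k a (k - a) m (2 * N - m) =
      qK ^ phiQ (2 * N) (Mvec (2 * N) k a (k - a) 0 (2 * N)) *
        zK ^ phiZ (2 * N) (Mvec (2 * N) k a (k - a) 0 (2 * N)) *
        (PhiK (m / 2) * PsiK (m / 2 + 1) (2 * N - (2 * N - m) / 2) *
          PhiVK ((2 * N - m) / 2)) := by
  rw [← PsiK_mul_PsiK (b := m) (by omega) (by omega), dmn, Mvec_diagonal N k a hm,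
    prod_Icc_reflect N (by omega), Nat.sub_sub_self hm,
    Finset.Icc_eq_empty (a := m + 1) (b := m) (by omega)]
  simp only [PhiK, PsiK, PhiVK, Finset.prod_inv_distrib, Finset.prod_empty, div_eq_mul_inv,
    mul_inv, mul_one]
  ring

lemma dmn_diagonal_even (N : ℕ) (k a : ℤ) {s : ℕ} (hs : s ≤ N) :
    dmn (2 * N) k a (k - a) (2 * s) (2 * N - 2 * s) =
      qK ^ phiQ (2 * N) (Mvec (2 * N) k a (k - a) 0 (2 * N)) *
        zK ^ phiZ (2 * N) (Mvec (2 * N) k a (k - a) 0 (2 * N)) *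
        (PhiK s * PsiK (s + 1) (N + s) * PhiVK (N - s)) := by
  rw [dmn_diagonal N k a (by omega), show 2 * s / 2 = s by omega,
    show (2 * N - 2 * s) / 2 = N - s by omega, show 2 * N - (N - s) = N + s by omega]

lemma dmn_diagonal_odd (N : ℕ) (k a : ℤ) {s : ℕ} (hs : s < N) :
    dmn (2 * N) k a (k - a) (2 * s + 1) (2 * N - (2 * s + 1)) =
      qK ^ phiQ (2 * N) (Mvec (2 * N) k a (k - a) 0 (2 * N)) *
        zK ^ phiZ (2 * N) (Mvec (2 * N) k a (k - a) 0 (2 * N)) *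
        (PhiK s * PsiK (s + 1) (N + s + 1) * PhiVK (N - s - 1)) := by
  rw [dmn_diagonal N k a (by omega), show (2 * s + 1) / 2 = s by omega,
    show (2 * N - (2 * s + 1)) / 2 = N - s - 1 by omega,
    show 2 * N - (N - s - 1) = N + s + 1 by omega]

lemma inv_one_sub_inv {F : Type*} [Field F] {x : F} (h : x ≠ 0) :
    (1 - x⁻¹)⁻¹ = -(x * (1 - x)⁻¹) := by
  have e : 1 - x⁻¹ = -(x⁻¹ * (1 - x)) := by
    rw [mul_sub, inv_mul_cancel₀ h]
    ring
  rw [e, inv_neg, mul_inv, inv_inv]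

/-- Adding the contribution of an odd index to an even partial sum. -/
lemma even_sub_odd (N s : ℕ) (hN : N ≠ 0) :
    (1 - qK ^ (-(N : ℤ)))⁻¹ * PsiK (s + 1) (N + s) - PsiK (s + 1) (N + s + 1) =
      -((1 - qK ^ (N : ℤ))⁻¹ * PsiK (s + 2) (N + s + 1)) := by
  have e₁ : PsiK (s + 1) (N + s) =
      (1 - qK ^ (-((N + s + 1 : ℕ) : ℤ)) * zK⁻¹) * PsiK (s + 1) (N + s + 1) := by
    rw [PsiK_succ_right (by omega), mul_comm, inv_mul_cancel_right₀]
    exact one_sub_qK_neg_mul_zK_inv_ne_zero _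
  have e₂ : PsiK (s + 2) (N + s + 1) =
      (1 - qK ^ (-((s + 1 : ℕ) : ℤ)) * zK⁻¹) * PsiK (s + 1) (N + s + 1) := by
    rw [PsiK_succ_left (a := s + 1) (by omega), mul_inv_cancel_left₀]
    exact one_sub_qK_neg_mul_zK_inv_ne_zero _
  rw [e₁, e₂, add_assoc N s 1, Nat.cast_add N (s + 1), neg_add, zpow_add₀ qK_ne_zero]
  simp only [zpow_neg, zpow_natCast]
  have h := qK_pow_ne_one_s16 hN
  have h₀ : qK ^ N ≠ 0 := pow_ne_zero _ qK_ne_zero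
  generalize qK ^ N = Q at *
  have h₁ : (1 - Q) * (1 - Q)⁻¹ = 1 := mul_inv_cancel₀ (sub_ne_zero.mpr h.symm)
  rw [inv_one_sub_inv h₀]
  linear_combination PsiK (s + 1) (N + (s + 1)) *
    (h₁ + (1 - Q)⁻¹ * (qK ^ (s + 1))⁻¹ * zK⁻¹ * mul_inv_cancel₀ h₀)

/-- Adding the contribution of an even index to an odd partial sum. -/
lemma odd_add_even (s n : ℕ) :
    -((1 - qK ^ ((s + 1 + (n + 1) : ℕ) : ℤ))⁻¹ * PhiK s * PhiVK (n + 1)) +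
        PhiK (s + 1) * PhiVK (n + 1) =
      (1 - qK ^ (-((s + 1 + (n + 1) : ℕ) : ℤ)))⁻¹ * PhiK (s + 1) * PhiVK n := by
  rw [PhiK_succ, PhiVK_succ]
  simp only [zpow_neg, zpow_natCast]
  have h := qK_pow_ne_one_s16 (i := s + 1 + (n + 1)) (by simp)
  have hx := qK_pow_ne_one_s16 (i := s + 1) (by simp)
  have hy := qK_pow_ne_one_s16 (i := n + 1) (by simp)
  have hx₀ : qK ^ (s + 1) ≠ 0 := pow_ne_zero _ qK_ne_zero
  have hy₀ : qK ^ (n + 1) ≠ 0 := pow_ne_zero _ qK_ne_zero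
  rw [pow_add qK (s + 1)] at *
  generalize qK ^ (s + 1) = x at *
  generalize qK ^ (n + 1) = y at *
  have hA : (1 - x) * (1 - x)⁻¹ = 1 := mul_inv_cancel₀ (sub_ne_zero.mpr hx.symm)
  have hC : (1 - y) * (1 - y)⁻¹ = 1 := mul_inv_cancel₀ (sub_ne_zero.mpr hy.symm)
  have hI : (1 - x * y) * (1 - x * y)⁻¹ = 1 := mul_inv_cancel₀ (sub_ne_zero.mpr h.symm)
  rw [inv_one_sub_inv hy₀, inv_one_sub_inv (mul_ne_zero hx₀ hy₀)]
  linear_combination PhiK s * PhiVK n * y *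
    (-(1 - x * y)⁻¹ * (1 - y)⁻¹ * hA + (1 - x)⁻¹ * (1 - y)⁻¹ * hI -
      x * (1 - x * y)⁻¹ * (1 - x)⁻¹ * hC)

theorem alternating_partial_sums (N : ℕ) (hN : 1 ≤ N) (k a : ℤ) (s : ℕ) (hs : s < N) :
    (∑ m ∈ Finset.range (2 * s + 1), (-1 : K) ^ m * dmn (2 * N) k a (k - a) m (2 * N - m) =
      qK ^ phiQ (2 * N) (Mvec (2 * N) k a (k - a) 0 (2 * N)) *
        zK ^ phiZ (2 * N) (Mvec (2 * N) k a (k - a) 0 (2 * N)) *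
        (1 - qK ^ (-(N : ℤ)))⁻¹ * PhiK s * PsiK (s + 1) (N + s) * PhiVK (N - s - 1)) ∧
    (∑ m ∈ Finset.range (2 * s + 2), (-1 : K) ^ m * dmn (2 * N) k a (k - a) m (2 * N - m) =
      -(qK ^ phiQ (2 * N) (Mvec (2 * N) k a (k - a) 0 (2 * N)) *
        zK ^ phiZ (2 * N) (Mvec (2 * N) k a (k - a) 0 (2 * N)) *
        (1 - qK ^ (N : ℤ))⁻¹ * PhiK s * PsiK (s + 2) (N + s + 1) * PhiVK (N - s - 1))) := by
  have odd_of_even : ∀ s < N,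
      ∑ m ∈ Finset.range (2 * s + 1), (-1 : K) ^ m * dmn (2 * N) k a (k - a) m (2 * N - m) =
        qK ^ phiQ (2 * N) (Mvec (2 * N) k a (k - a) 0 (2 * N)) *
          zK ^ phiZ (2 * N) (Mvec (2 * N) k a (k - a) 0 (2 * N)) *
          (1 - qK ^ (-(N : ℤ)))⁻¹ * PhiK s * PsiK (s + 1) (N + s) * PhiVK (N - s - 1) →
      ∑ m ∈ Finset.range (2 * s + 2), (-1 : K) ^ m * dmn (2 * N) k a (k - a) m (2 * N - m) =
        -(qK ^ phiQ (2 * N) (Mvec (2 * N) k a (k - a) 0 (2 * N)) *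
          zK ^ phiZ (2 * N) (Mvec (2 * N) k a (k - a) 0 (2 * N)) *
          (1 - qK ^ (N : ℤ))⁻¹ * PhiK s * PsiK (s + 2) (N + s + 1) * PhiVK (N - s - 1)) := by
    intro s hs h
    rw [Finset.sum_range_succ, h, dmn_diagonal_odd N k a hs,
      Odd.neg_one_pow (odd_two_mul_add_one s)]
    linear_combination qK ^ phiQ (2 * N) (Mvec (2 * N) k a (k - a) 0 (2 * N)) *
      zK ^ phiZ (2 * N) (Mvec (2 * N) k a (k - a) 0 (2 * N)) * PhiK s * PhiVK (N - s - 1) *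
      even_sub_odd N s (by omega)
  induction s with
  | zero =>
    refine (fun h => ⟨h, odd_of_even 0 hs h⟩) ?_
    have h := dmn_diagonal_even N k a (Nat.zero_le N)
    have hV := PhiVK_succ (N - 1)
    rw [Nat.sub_add_cancel hN] at hV
    rw [mul_zero, zero_add, Finset.sum_range_one, pow_zero, one_mul]
    rw [mul_zero] at h
    rw [h, Nat.sub_zero, hV, zpow_neg, zpow_natCast]
    ring
  | succ s ih =>
    refine (fun h => ⟨h, odd_of_even (s + 1) hs h⟩) ?_
    obtain ⟨n, rfl⟩ : ∃ n, N = s + 1 + (n + 1) := ⟨N - s - 2, by omega⟩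
    rw [Finset.sum_range_succ, show 2 * (s + 1) = 2 * s + 2 by ring, (ih (by omega)).2,
      ← show 2 * (s + 1) = 2 * s + 2 by ring, dmn_diagonal_even _ k a (by omega),
      Even.neg_one_pow (even_two_mul (s + 1)),
      show s + 1 + (n + 1) - s - 1 = n + 1 by omega,
      show s + 1 + (n + 1) - (s + 1) = n + 1 by omega, Nat.add_sub_cancel,
      ← add_assoc (s + 1 + (n + 1)) s 1]
    linear_combination
      qK ^ phiQ (2 * (s + 1 + (n + 1))) (Mvec _ k a (k - a) 0 (2 * (s + 1 + (n + 1)))) *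
      zK ^ phiZ (2 * (s + 1 + (n + 1))) (Mvec _ k a (k - a) 0 (2 * (s + 1 + (n + 1)))) *
      PsiK (s + 2) (s + 1 + (n + 1) + s + 1) * odd_add_even s n

end
end
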